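/- Let G be a p×p real symmetric matrix with eigenvalues λ₁ ≥ λ₂ ≥ ⋯ ≥ λ_p, and let Γ₀ ∈ ℝ^{p×d} and Γ₀⊥ ∈ ℝ^{p×(p−d)} satisfy [Γ₀ Γ₀⊥]ᵀ[Γ₀ Γ₀⊥] = I_p and G Γ₀ = Γ₀ Λ₁ with Λ₁ = diag(λ₁, …, λ_d). Then for every Z = Γ₀A + Γ₀⊥B with A ∈ ℝ^{d×d} skew-symmetric and B ∈ ℝ^{(p−d)×d} arbitrary, tr(ZᵀZ Λ₁) − tr(Zᵀ G Z) ≥ (λ_d − λ_{d+1}) ‖B‖_s², where ‖B‖_s = sqrt(tr(BᵀB)) is the Frobenius norm. -/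

import Mathlib

open Matrix

lemma aux_vanish (p d m : ℕ) (hdp : d < p) (lam : Fin p → ℝ)
    (hmono : ∀ i j : Fin p, i ≤ j → lam j ≤ lam i)
    (Q : Matrix (Fin p) (Fin d) ℝ) (hQ : Qᵀ * Q = 1)
    (hQL : Matrix.diagonal lam * Q =
      Q * Matrix.diagonal (fun j : Fin d => lam (Fin.castLE hdp.le j)))
    (W : Matrix (Fin p) (Fin m) ℝ) (hW : Qᵀ * W = 0)
    (i : Fin p) (hi : lam ⟨d, hdp⟩ < lam i) (k : Fin m) : W i k = 0 := by
  classical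
  let S := {i : Fin p // lam ⟨d, hdp⟩ < lam i}
  have hlt : ∀ i : S, i.1.1 < d := by
    intro i
    by_contra h
    have := hmono ⟨d, hdp⟩ i.1 (by rw [Fin.le_def]; simpa using h)
    exact absurd i.2 (not_lt.mpr this)
  let e : S → Fin d := fun i => ⟨i.1.1, hlt i⟩
  have he : ∀ i : S, Fin.castLE hdp.le (e i) = i.1 := fun i => rfl
  have heinj : Function.Injective e := by
    intro a b h
    apply Subtype.ext
    rw [← he a, ← he b, h]
  have hz : ∀ (i : Fin p) (j : S), ¬ (lam ⟨d, hdp⟩ < lam i) → Q i (e j) = 0 := by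
    intro i j hij
    have := congrFun (congrFun hQL i) (e j)
    rw [Matrix.diagonal_mul, Matrix.mul_diagonal, he] at this
    have hne : lam i - lam j.1 ≠ 0 := by
      have := j.2
      intro h
      apply hij
      linarith
    have h0 : (lam i - lam j.1) * Q i (e j) = 0 := by linarith
    exact (mul_eq_zero.mp h0).resolve_left hne
  have hsum : ∀ (j : S) (f : Fin p → ℝ),
      ∑ i : S, Q i.1 (e j) * f i.1 = ∑ i, Q i (e j) * f i := by
    intro j f
    rw [← Fintype.sum_subtype_add_sum_subtype (fun i => lam ⟨d, hdp⟩ < lam i)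
      (fun i => Q i (e j) * f i)]
    rw [left_eq_add]
    apply Finset.sum_eq_zero
    intro x _
    rw [hz x.1 j x.2, zero_mul]
  let R : Matrix S S ℝ := Matrix.of fun i j => Q i.1 (e j)
  let V : Matrix S (Fin m) ℝ := Matrix.of fun i k => W i.1 k
  have hR : Rᵀ * R = 1 := by
    ext a b
    have h := congrFun (congrFun hQ (e a)) (e b)
    rw [Matrix.mul_apply] at h ⊢
    refine (hsum a (fun i => Q i (e b))).trans (h.trans ?_)
    simp only [Matrix.one_apply, heinj.eq_iff]
  have hV : Rᵀ * V = 0 := by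
    ext a b
    have h := congrFun (congrFun hW (e a)) b
    rw [Matrix.mul_apply] at h ⊢
    exact (hsum a (fun i => W i b)).trans h
  have hR' : R * Rᵀ = 1 := mul_eq_one_comm.mp hR
  have : V = 0 := by
    rw [← Matrix.one_mul V, ← hR', Matrix.mul_assoc, hV, Matrix.mul_zero]
  exact congrFun (congrFun this ⟨i, hi⟩) k

/-- Let `G` be symmetric with eigenvalues `λ₁ ≥ ⋯ ≥ λ_p`
(witnessed by an orthogonal eigendecomposition with nonincreasing `λ`), let
`[Γ₀ Γ₀⊥]` be orthogonal with `G Γ₀ = Γ₀ Λ₁`, `Λ₁ = diag(λ₁, …, λ_d)`. Then for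
every tangent vector `Z = Γ₀A + Γ₀⊥B` (`A` skew-symmetric),
`tr(ZᵀZ Λ₁) − tr(Zᵀ G Z) ≥ (λ_d − λ_{d+1}) ‖B‖_s²` with
`‖B‖_s² = tr(BᵀB)`. -/
theorem eigen_gap_trace_inequality
    (p d : ℕ) (hd : 1 ≤ d) (hdp : d < p)
    (G : Matrix (Fin p) (Fin p) ℝ) (hG : Gᵀ = G)
    (lam : Fin p → ℝ) (hmono : ∀ i j : Fin p, i ≤ j → lam j ≤ lam i)
    (U : Matrix (Fin p) (Fin p) ℝ) (hU : Uᵀ * U = 1)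
    (hGU : G = U * Matrix.diagonal lam * Uᵀ)
    (Γ0 : Matrix (Fin p) (Fin d) ℝ) (Γ0perp : Matrix (Fin p) (Fin (p - d)) ℝ)
    (h1 : Γ0ᵀ * Γ0 = 1) (h2 : Γ0perpᵀ * Γ0perp = 1) (h3 : Γ0perpᵀ * Γ0 = 0)
    (hGΓ : G * Γ0 =
        Γ0 * Matrix.diagonal (fun j : Fin d => lam (Fin.castLE hdp.le j)))
    (A : Matrix (Fin d) (Fin d) ℝ) (hA : A + Aᵀ = 0)
    (B : Matrix (Fin (p - d)) (Fin d) ℝ)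
    (Z : Matrix (Fin p) (Fin d) ℝ) (hZ : Z = Γ0 * A + Γ0perp * B) :
    (lam ⟨d - 1, by omega⟩ - lam ⟨d, hdp⟩) * Matrix.trace (Bᵀ * B) ≤
      Matrix.trace
          (Zᵀ * Z * Matrix.diagonal (fun j : Fin d => lam (Fin.castLE hdp.le j))) -
        Matrix.trace (Zᵀ * G * Z) := by
  set L := Matrix.diagonal (fun j : Fin d => lam (Fin.castLE hdp.le j)) with hL
  have hLT : Lᵀ = L := Matrix.diagonal_transpose _
  have hAT : Aᵀ = -A := by rw [eq_neg_iff_add_eq_zero, add_comm]; exact hA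
  have hUU : U * Uᵀ = 1 := mul_eq_one_comm.mp hU
  have h3' : Γ0ᵀ * Γ0perp = 0 := by
    have := congrArg Matrix.transpose h3
    simpa using this
  have hGΓ' : Γ0ᵀ * G = L * Γ0ᵀ := by
    have := congrArg Matrix.transpose hGΓ
    simpa [hG, hLT] using this
  set Y := Γ0perp * B with hY
  have hGY : Γ0ᵀ * Y = 0 := by rw [hY, ← Matrix.mul_assoc, h3', Matrix.zero_mul]
  have hYG : Yᵀ * Γ0 = 0 := by
    have := congrArg Matrix.transpose hGY
    simpa using this
  have hYY : Yᵀ * Y = Bᵀ * B := by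
    rw [hY, Matrix.transpose_mul, Matrix.mul_assoc, ← Matrix.mul_assoc Γ0perpᵀ, h2, Matrix.one_mul]
  have hZZ : Zᵀ * Z = Aᵀ * A + Bᵀ * B := by
    have e1 : Zᵀ * Z = Aᵀ * (Γ0ᵀ * Γ0) * A + Aᵀ * (Γ0ᵀ * Y) + (Yᵀ * Γ0) * A + Yᵀ * Y := by
      rw [hZ]
      simp only [Matrix.transpose_add, Matrix.transpose_mul Γ0 A, Matrix.add_mul, Matrix.mul_add,
        Matrix.mul_assoc]
      abel
    rw [e1, h1, hGY, hYG, hYY]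
    simp
  have hZGZ : Zᵀ * G * Z = Aᵀ * L * A + Yᵀ * G * Y := by
    have e1 : Zᵀ * G * Z = Aᵀ * (Γ0ᵀ * (G * Γ0)) * A + Aᵀ * ((Γ0ᵀ * G) * Y)
        + (Yᵀ * (G * Γ0)) * A + Yᵀ * G * Y := by
      rw [hZ]
      simp only [Matrix.transpose_add, Matrix.transpose_mul Γ0 A, Matrix.add_mul, Matrix.mul_add,
        Matrix.mul_assoc]
      abel
    rw [e1, hGΓ, hGΓ', Matrix.mul_assoc L, hGY, ← Matrix.mul_assoc Γ0ᵀ, h1,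
      ← Matrix.mul_assoc Yᵀ Γ0, hYG]
    simp
  have hAA : Matrix.trace (Aᵀ * A * L) = Matrix.trace (Aᵀ * L * A) := by
    rw [Matrix.trace_mul_cycle Aᵀ L A, hAT]
    simp
  have hB1 : lam ⟨d - 1, by omega⟩ * Matrix.trace (Bᵀ * B) ≤ Matrix.trace (Bᵀ * B * L) := by
    simp only [Matrix.trace, Matrix.diag_apply, hL, Matrix.mul_diagonal]
    rw [Finset.mul_sum]
    apply Finset.sum_le_sum
    intro j _
    rw [mul_comm]
    apply mul_le_mul_of_nonneg_left
    · apply hmono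
      rw [Fin.le_def]
      simp only [Fin.val_castLE]
      omega
    · rw [Matrix.mul_apply]
      exact Finset.sum_nonneg fun i _ => mul_self_nonneg (B i j)
  have hB2 : Matrix.trace (Yᵀ * G * Y) ≤ lam ⟨d, hdp⟩ * Matrix.trace (Bᵀ * B) := by
    set W := Uᵀ * Y with hWdef
    have e1 : Yᵀ * G * Y = Wᵀ * (Matrix.diagonal lam * W) := by
      rw [hGU, hWdef, Matrix.transpose_mul Uᵀ Y, Matrix.transpose_transpose]
      simp only [Matrix.mul_assoc]
    have e2 : Bᵀ * B = Wᵀ * W := by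
      rw [← hYY, hWdef, Matrix.transpose_mul Uᵀ Y, Matrix.transpose_transpose, Matrix.mul_assoc Yᵀ U,
        ← Matrix.mul_assoc U, hUU, Matrix.one_mul]
    have hv : ∀ i, lam ⟨d, hdp⟩ < lam i → ∀ k, W i k = 0 := by
      intro i hi k
      refine aux_vanish p d d hdp lam hmono (Uᵀ * Γ0) ?_ ?_ W ?_ i hi k
      · rw [Matrix.transpose_mul, Matrix.transpose_transpose, Matrix.mul_assoc,
          ← Matrix.mul_assoc U, hUU, Matrix.one_mul, h1]
      · rw [← hL, Matrix.mul_assoc Uᵀ, ← hGΓ, hGU]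
        simp only [← Matrix.mul_assoc]
        rw [hU, Matrix.one_mul]
      · rw [hWdef, Matrix.transpose_mul, Matrix.transpose_transpose, Matrix.mul_assoc,
          ← Matrix.mul_assoc U, hUU, Matrix.one_mul, hGY]
    rw [e1, e2]
    simp only [Matrix.trace, Matrix.diag_apply]
    rw [Finset.mul_sum]
    apply Finset.sum_le_sum
    intro k _
    rw [Matrix.mul_apply, Matrix.mul_apply, Finset.mul_sum]
    apply Finset.sum_le_sum
    intro i _
    rw [Matrix.diagonal_mul, Matrix.transpose_apply]
    by_cases hi : lam ⟨d, hdp⟩ < lam i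
    · simp [hv i hi k]
    · have := mul_le_mul_of_nonneg_right (not_lt.mp hi) (mul_self_nonneg (W i k))
      linarith
  rw [hZZ, hZGZ, Matrix.add_mul, Matrix.trace_add, Matrix.trace_add, hAA]
  linarith
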